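/- Let X and X' be modal formulas in system T. Then X ≡ X' if and only if Π(X) ≡ Π(X'), where a set of clauses is identified with the conjunction of its elements. -/

import Mathlib

inductive MF : Type
  | var : ℕ → MF
  | neg : MF → MF
  | and : MF → MF → MF
  | or  : MF → MF → MF
  | box : MF → MF
  | dia : MF → MF

structure Kripke where
  W : Type
  ne : Nonempty W
  R : W → W → Prop
  v : W → ℕ → Prop

/-- A Kripke model of system T: the accessibility relation is reflexive. -/
def IsT (M : Kripke) : Prop := ∀ w, M.R w w

/-- Truth of a modal formula at a world of a Kripke model. -/
def MF.sat (M : Kripke) : MF → M.W → Prop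
  | var n, w => M.v w n
  | neg φ, w => ¬ MF.sat M φ w
  | and φ ψ, w => MF.sat M φ w ∧ MF.sat M ψ w
  | or φ ψ, w => MF.sat M φ w ∨ MF.sat M ψ w
  | box φ, w => ∀ w', M.R w w' → MF.sat M φ w'
  | dia φ, w => ∃ w', M.R w w' ∧ MF.sat M φ w'

/-- φ is true at every world of M. -/
def globalTrue (M : Kripke) (φ : MF) : Prop := ∀ w, MF.sat M φ w

/-- Global entailment in system T (over reflexive Kripke models). -/
def entailsT (φ ψ : MF) : Prop :=
  ∀ M : Kripke, IsT M → globalTrue M φ → globalTrue M ψ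

/-- Global equivalence in system T. -/
def equivT (φ ψ : MF) : Prop := entailsT φ ψ ∧ entailsT ψ φ

/-- A formula is propositional if it contains no modal operators. -/
def Propositional : MF → Prop
  | .var _ => True
  | .neg φ => Propositional φ
  | .and φ ψ => Propositional φ ∧ Propositional ψ
  | .or φ ψ => Propositional φ ∧ Propositional ψ
  | .box _ => False
  | .dia _ => False

/-- X₁ ⊨_Y X₂ iff X₁ ∧ Y ⊨ X₂ (system T). -/
def entailsWT (Y X₁ X₂ : MF) : Prop := entailsT (X₁.and Y) X₂

/-- X₁ ≡_Y X₂ (system T). -/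
def equivWT (Y X₁ X₂ : MF) : Prop := entailsWT Y X₁ X₂ ∧ entailsWT Y X₂ X₁

inductive IsLiteral : MF → Prop
  | var (n : ℕ) : IsLiteral (.var n)
  | nvar (n : ℕ) : IsLiteral (.neg (.var n))
  | box (φ : MF) : IsLiteral (.box φ)
  | dia (φ : MF) : IsLiteral (.dia φ)

inductive IsClause : MF → Prop
  | lit {φ : MF} : IsLiteral φ → IsClause φ
  | or {φ ψ : MF} : IsClause φ → IsClause ψ → IsClause (.or φ ψ)

/-- C is an implicate of X (system T). -/
def ImplicateT (X C : MF) : Prop := IsClause C ∧ entailsT X C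

/-- C is a prime implicate of X (system T). -/
def PrimeImplicateT (X C : MF) : Prop :=
  ImplicateT X C ∧ ∀ C', ImplicateT X C' → entailsT C' C → equivT C' C

/-- Π(X) : the set of prime implicates of X (system T). -/
def PiT (X : MF) : Set MF := {C | PrimeImplicateT X C}

/-- C is a theory implicate of X with respect to Y (system T). -/
def TheoryImplicateT (Y X C : MF) : Prop := IsClause C ∧ entailsWT Y X C

/-- C is a theory prime implicate of X with respect to Y (system T). -/
def TheoryPrimeImplicateT (Y X C : MF) : Prop :=
  TheoryImplicateT Y X C ∧ ∀ C', TheoryImplicateT Y X C' → entailsWT Y C' C → equivWT Y C' C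

/-- Θ(X,Y) : the set of theory prime implicates of X with respect to Y (system T). -/
def ThetaT (X Y : MF) : Set MF := {C | TheoryPrimeImplicateT Y X C}

/-- Global entailment between sets of formulas (identified with the
conjunction of their elements), in system T. -/
def entailsSetT (S T : Set MF) : Prop :=
  ∀ M : Kripke, IsT M → (∀ φ ∈ S, globalTrue M φ) → ∀ φ ∈ T, globalTrue M φ

/-- Over a reflexive model, global truth of `□φ` and of `φ` coincide. -/
theorem globalTrue_box_iff {M : Kripke} (hM : IsT M) (φ : MF) :
    globalTrue M φ.box ↔ globalTrue M φ :=
  ⟨fun h w => h w w (hM w), fun h _ w' _ => h w'⟩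

/-- The clause `□X` is a prime implicate of `X`. -/
theorem primeImplicateT_box (X : MF) : PrimeImplicateT X X.box :=
  ⟨⟨.lit (.box X), fun _ hM h => (globalTrue_box_iff hM X).2 h⟩,
    fun _ hC' hC'X => ⟨hC'X, fun M hM h => hC'.2 M hM ((globalTrue_box_iff hM X).1 h)⟩⟩

/-- A formula has the same reflexive models as its set of prime implicates. -/
theorem forall_piT_globalTrue_iff {M : Kripke} (hM : IsT M) (X : MF) :
    (∀ φ ∈ PiT X, globalTrue M φ) ↔ globalTrue M X :=
  ⟨fun h => (globalTrue_box_iff hM X).1 (h _ (primeImplicateT_box X)),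
    fun h _ hφ => hφ.1.2 M hM h⟩

/-- Entailment between formulas agrees with entailment between their sets of prime implicates. -/
theorem entailsSetT_piT_iff (X X' : MF) : entailsSetT (PiT X) (PiT X') ↔ entailsT X X' :=
  forall₂_congr fun _ hM =>
    imp_congr (forall_piT_globalTrue_iff hM X) (forall_piT_globalTrue_iff hM X')

/-- in system T, X ≡ X' iff Π(X) ≡ Π(X') (sets identified with
the conjunction of their elements). -/
theorem plain_equivalence (X X' : MF) :
    equivT X X' ↔
      (entailsSetT (PiT X) (PiT X') ∧ entailsSetT (PiT X') (PiT X)) := by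
  rw [entailsSetT_piT_iff, entailsSetT_piT_iff, equivT]
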